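/- Let X be an n×p real matrix and s an integer with 1 ≤ 2s ≤ p. For all disjoint sets T, T' ⊆ {1,…,p} with |T| ≤ s and |T'| ≤ s, and all vectors u, u' ∈ ℝ^p supported on T and T' respectively, |⟨Xu, Xu'⟩|/n ≤ min(√(Λ_max(|T|)·Λ_max(|T'|)), Λ_max(2s)/2)·‖u‖₂·‖u'‖₂. Consequently θ_{m,m'} ≤ min(Λ_max(s), Λ_max(2s)/2) for all m, m' with 1 ≤ m, m' ≤ s. -/

import Mathlib

open Finset Matrix Real
open scoped BigOperators Classical

noncomputable section

namespace ThreshLasso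

/-- ℓ₂ norm of a finite real vector. -/
def l2 {m : ℕ} (v : Fin m → ℝ) : ℝ := Real.sqrt (∑ i, (v i) ^ 2)

/-- ℓ₁ norm of a finite real vector. -/
def l1 {m : ℕ} (v : Fin m → ℝ) : ℝ := ∑ i, |v i|

/-- Restriction of a vector to a set of coordinates (zero outside). -/
def restr {p : ℕ} (v : Fin p → ℝ) (T : Finset (Fin p)) : Fin p → ℝ :=
  fun j => if j ∈ T then v j else 0

/-- Support of a vector, as a `Finset`. -/
def supp {p : ℕ} (v : Fin p → ℝ) : Finset (Fin p) :=
  Finset.univ.filter fun j => v j ≠ 0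

/-- `L` is the minimal `m`-sparse eigenvalue `Λ_min(m)` of `X`:
the least value of `‖Xv‖₂²/(n‖v‖₂²)` over nonzero `v` with at most `m`
nonzero coordinates. -/
def IsLambdaMin {n p : ℕ} (X : Matrix (Fin n) (Fin p) ℝ) (m : ℕ) (L : ℝ) : Prop :=
  IsLeast {r : ℝ | ∃ v : Fin p → ℝ, v ≠ 0 ∧ (supp v).card ≤ m ∧
    r = (l2 (X.mulVec v)) ^ 2 / (n * (l2 v) ^ 2)} L

/-- `L` is the maximal `m`-sparse eigenvalue `Λ_max(m)` of `X`
(with the convention `Λ_max(0) = 0`, implemented by inserting `0` in the set,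
which does not change the maximum when `m ≥ 1`). -/
def IsLambdaMax {n p : ℕ} (X : Matrix (Fin n) (Fin p) ℝ) (m : ℕ) (L : ℝ) : Prop :=
  IsGreatest (insert (0 : ℝ) {r : ℝ | ∃ v : Fin p → ℝ, v ≠ 0 ∧ (supp v).card ≤ m ∧
    r = (l2 (X.mulVec v)) ^ 2 / (n * (l2 v) ^ 2)}) L

/-- `θ` is the restricted orthogonality constant `θ_{m,m'}` of `X`: the smallest
nonnegative `t` such that `|⟨Xu, Xu'⟩|/n ≤ t‖u‖₂‖u'‖₂` for all `u, u'` supported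
on disjoint sets of cardinality at most `m`, `m'` respectively. -/
def IsTheta {n p : ℕ} (X : Matrix (Fin n) (Fin p) ℝ) (m m' : ℕ) (θ : ℝ) : Prop :=
  IsLeast {t : ℝ | 0 ≤ t ∧ ∀ (u u' : Fin p → ℝ) (T T' : Finset (Fin p)),
    Disjoint T T' → T.card ≤ m → T'.card ≤ m' →
    (∀ j, j ∉ T → u j = 0) → (∀ j, j ∉ T' → u' j = 0) →
    |∑ i, (X.mulVec u i) * (X.mulVec u' i)| / n ≤ t * (l2 u * l2 u')} θ

/-- Restricted eigenvalue condition `RE(s₀, k₀, X)` with constant `K`. -/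
def RECond {n p : ℕ} (X : Matrix (Fin n) (Fin p) ℝ) (s₀ : ℕ) (k₀ K : ℝ) : Prop :=
  0 < K ∧ ∀ (v : Fin p → ℝ) (J : Finset (Fin p)), J.card ≤ s₀ →
    l1 (restr v Jᶜ) ≤ k₀ * l1 (restr v J) →
    l2 (restr v J) / K ≤ l2 (X.mulVec v) / Real.sqrt n

/-- `s₀` is the essential sparsity of `β`: the smallest nonnegative integer `m`
with `∑ᵢ min(βᵢ², λ²σ²) ≤ m λ²σ²`. -/
def EssSparsity {p : ℕ} (β : Fin p → ℝ) (lam σ : ℝ) (s₀ : ℕ) : Prop :=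
  IsLeast {m : ℕ | ∑ i, min ((β i) ^ 2) (lam ^ 2 * σ ^ 2) ≤ (m : ℝ) * (lam ^ 2 * σ ^ 2)} s₀

/-- `T₀` is a set of indices of the `s₀` largest coordinates of `β` in absolute value. -/
def TopSet {p : ℕ} (β : Fin p → ℝ) (s₀ : ℕ) (T₀ : Finset (Fin p)) : Prop :=
  T₀.card = s₀ ∧ ∀ i ∈ T₀, ∀ j, j ∉ T₀ → |β j| ≤ |β i|

/-- `T₁` is a set of indices of the `s₀` largest coordinates of `h` in absolute
value outside `T₀`. -/
def TopSetOutside {p : ℕ} (h : Fin p → ℝ) (s₀ : ℕ) (T₀ T₁ : Finset (Fin p)) : Prop :=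
  T₁.card = s₀ ∧ Disjoint T₀ T₁ ∧
    ∀ i ∈ T₁, ∀ j, j ∉ T₀ → j ∉ T₁ → |h j| ≤ |h i|

/-- `b` is a Lasso minimizer with penalty `lamn` for data `(X, Y)`. -/
def IsLassoSol {n p : ℕ} (X : Matrix (Fin n) (Fin p) ℝ) (Y : Fin n → ℝ)
    (lamn : ℝ) (b : Fin p → ℝ) : Prop :=
  ∀ b' : Fin p → ℝ,
    1 / (2 * n) * (l2 (Y - X.mulVec b)) ^ 2 + lamn * l1 b ≤
    1 / (2 * n) * (l2 (Y - X.mulVec b')) ^ 2 + lamn * l1 b'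

/-- Submatrix of the columns of `X` indexed by `I`. -/
def colSub {n p : ℕ} (X : Matrix (Fin n) (Fin p) ℝ) (I : Finset (Fin p)) :
    Matrix (Fin n) {j // j ∈ I} ℝ :=
  Matrix.of fun i j => X i j.1

/-- The Gram matrix `X_Iᵀ X_I` is invertible. -/
def GramInvertible {n p : ℕ} (X : Matrix (Fin n) (Fin p) ℝ) (I : Finset (Fin p)) : Prop :=
  IsUnit ((colSub X I)ᵀ * colSub X I).det

/-- The OLS refit of `Y` on the columns of `X` indexed by `I`:
`(X_Iᵀ X_I)⁻¹ X_Iᵀ Y` on `I`, and `0` off `I`. -/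
def olsRefit {n p : ℕ} (X : Matrix (Fin n) (Fin p) ℝ) (Y : Fin n → ℝ)
    (I : Finset (Fin p)) : Fin p → ℝ :=
  fun j => if h : j ∈ I then
    (((colSub X I)ᵀ * colSub X I)⁻¹).mulVec ((colSub X I)ᵀ.mulVec Y) ⟨j, h⟩
  else 0


lemma l2_nonneg {m : ℕ} (v : Fin m → ℝ) : 0 ≤ l2 v := Real.sqrt_nonneg _

lemma l2_sq {m : ℕ} (v : Fin m → ℝ) : l2 v ^ 2 = ∑ i, v i ^ 2 :=
  Real.sq_sqrt (Finset.sum_nonneg fun _ _ => sq_nonneg _)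

lemma l2_eq_zero {m : ℕ} {v : Fin m → ℝ} : l2 v = 0 ↔ v = 0 := by
  rw [← sq_eq_zero_iff, l2_sq, Finset.sum_eq_zero_iff_of_nonneg fun _ _ => sq_nonneg _]
  simp [funext_iff]

lemma abs_sum_mul_le_l2_mul_l2 {m : ℕ} (v w : Fin m → ℝ) :
    |∑ i, v i * w i| ≤ l2 v * l2 w := by
  refine abs_le_of_sq_le_sq ?_ (mul_nonneg (l2_nonneg v) (l2_nonneg w))
  rw [mul_pow, l2_sq, l2_sq]
  exact Finset.sum_mul_sq_le_sq_mul_sq _ _ _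

lemma card_supp_le {p : ℕ} {v : Fin p → ℝ} {T : Finset (Fin p)}
    (hv : ∀ j, j ∉ T → v j = 0) : (supp v).card ≤ T.card := by
  refine Finset.card_le_card fun j hj => ?_
  by_contra h
  exact (Finset.mem_filter.mp hj).2 (hv j h)

lemma IsLambdaMax.nonneg {n p k : ℕ} {X : Matrix (Fin n) (Fin p) ℝ} {L : ℝ}
    (hL : IsLambdaMax X k L) : 0 ≤ L :=
  hL.2 (Set.mem_insert _ _)

lemma IsLambdaMax.l2_mulVec_sq_le {n p k : ℕ} (hn : 0 < n) {X : Matrix (Fin n) (Fin p) ℝ}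
    {L : ℝ} (hL : IsLambdaMax X k L) {v : Fin p → ℝ} {T : Finset (Fin p)} (hT : T.card ≤ k)
    (hv : ∀ j, j ∉ T → v j = 0) : l2 (X.mulVec v) ^ 2 ≤ n * L * l2 v ^ 2 := by
  by_cases h0 : v = 0
  · subst h0
    simp [l2]
  have hpos : 0 < l2 v := (l2_nonneg v).lt_of_ne' fun h => h0 (l2_eq_zero.mp h)
  have hn' : (0 : ℝ) < n := Nat.cast_pos.mpr hn
  have h := hL.2 (Set.mem_insert_of_mem _ ⟨v, h0, (card_supp_le hv).trans hT, rfl⟩)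
  rw [div_le_iff₀ (by positivity)] at h
  linarith

/-- The Cauchy–Schwarz bound through the sparse eigenvalues of the two separate supports. -/
lemma abs_sum_mulVec_mul_div_le_sqrt {n p k k' : ℕ} (hn : 0 < n)
    {X : Matrix (Fin n) (Fin p) ℝ} {L L' : ℝ} (hL : IsLambdaMax X k L)
    (hL' : IsLambdaMax X k' L') {u u' : Fin p → ℝ} {T T' : Finset (Fin p)}
    (hT : T.card ≤ k) (hT' : T'.card ≤ k')
    (hu : ∀ j, j ∉ T → u j = 0) (hu' : ∀ j, j ∉ T' → u' j = 0) :
    |∑ i, X.mulVec u i * X.mulVec u' i| / n ≤ √(L * L') * (l2 u * l2 u') := by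
  have hn' : (0 : ℝ) < n := Nat.cast_pos.mpr hn
  have hu0 := l2_nonneg u
  have hu0' := l2_nonneg u'
  rw [div_le_iff₀ hn']
  refine (abs_sum_mul_le_l2_mul_l2 _ _).trans (le_of_abs_le (abs_le_of_sq_le_sq ?_ (by positivity)))
  calc (l2 (X.mulVec u) * l2 (X.mulVec u')) ^ 2
      = l2 (X.mulVec u) ^ 2 * l2 (X.mulVec u') ^ 2 := mul_pow _ _ _
    _ ≤ (n * L * l2 u ^ 2) * (n * L' * l2 u' ^ 2) := by
      have := hL.nonneg
      gcongr
      · exact hL.l2_mulVec_sq_le hn hT hu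
      · exact hL'.l2_mulVec_sq_le hn hT' hu'
    _ = (√(L * L') * (l2 u * l2 u') * n) ^ 2 := by
      rw [mul_pow, mul_pow, Real.sq_sqrt (mul_nonneg hL.nonneg hL'.nonneg)]
      ring

lemma l2_smul_add_smul_sq {p : ℕ} {u u' : Fin p → ℝ} {T T' : Finset (Fin p)}
    (hd : Disjoint T T') (hu : ∀ j, j ∉ T → u j = 0) (hu' : ∀ j, j ∉ T' → u' j = 0)
    (a b : ℝ) : l2 (a • u + b • u') ^ 2 = a ^ 2 * l2 u ^ 2 + b ^ 2 * l2 u' ^ 2 := by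
  simp only [l2_sq, Finset.mul_sum, ← Finset.sum_add_distrib]
  refine Finset.sum_congr rfl fun j _ => ?_
  have h : u j * u' j = 0 := by
    by_cases hj : j ∈ T
    · rw [hu' j (Finset.disjoint_left.mp hd hj), mul_zero]
    · rw [hu j hj, zero_mul]
  simp only [Pi.add_apply, Pi.smul_apply, smul_eq_mul]
  linear_combination 2 * a * b * h

/-- The polarization bound through the sparse eigenvalue of the union of the supports. -/
lemma abs_sum_mulVec_mul_div_le_half {n p k : ℕ} (hn : 0 < n)
    {X : Matrix (Fin n) (Fin p) ℝ} {L : ℝ} (hL : IsLambdaMax X k L)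
    {u u' : Fin p → ℝ} {T T' : Finset (Fin p)} (hd : Disjoint T T')
    (hT : T.card + T'.card ≤ k)
    (hu : ∀ j, j ∉ T → u j = 0) (hu' : ∀ j, j ∉ T' → u' j = 0) :
    |∑ i, X.mulVec u i * X.mulVec u' i| / n ≤ L / 2 * (l2 u * l2 u') := by
  have hn' : (0 : ℝ) < n := Nat.cast_pos.mpr hn
  rw [div_le_iff₀ hn']
  by_cases h0 : u = 0
  · subst h0
    simp [l2]
  by_cases h0' : u' = 0
  · subst h0'
    simp [l2]
  have ha : 0 < l2 u := (l2_nonneg u).lt_of_ne' fun h => h0 (l2_eq_zero.mp h)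
  have hb : 0 < l2 u' := (l2_nonneg u').lt_of_ne' fun h => h0' (l2_eq_zero.mp h)
  set S := ∑ i, X.mulVec u i * X.mulVec u' i
  have hexp (a b : ℝ) : l2 (X.mulVec (a • u + b • u')) ^ 2
      = a ^ 2 * l2 (X.mulVec u) ^ 2 + b ^ 2 * l2 (X.mulVec u') ^ 2 + 2 * a * b * S := by
    simp only [S, Matrix.mulVec_add, Matrix.mulVec_smul, l2_sq, Finset.mul_sum,
      ← Finset.sum_add_distrib, Pi.add_apply, Pi.smul_apply, smul_eq_mul]
    exact Finset.sum_congr rfl fun i _ => by ring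
  have hbound (a b : ℝ) : l2 (X.mulVec (a • u + b • u')) ^ 2
      ≤ n * L * (a ^ 2 * l2 u ^ 2 + b ^ 2 * l2 u' ^ 2) := by
    rw [← l2_smul_add_smul_sq hd hu hu' a b]
    refine hL.l2_mulVec_sq_le hn (T := T ∪ T')
      ((Finset.card_union_le T T').trans hT) fun j hj => ?_
    rw [Finset.mem_union, not_or] at hj
    simp [hu j hj.1, hu' j hj.2]
  have hab : 0 < l2 u * l2 u' := mul_pos ha hb
  have hpos := hbound (l2 u') (l2 u)
  have hneg := hbound (l2 u') (-l2 u)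
  have hpos0 := sq_nonneg (l2 (X.mulVec (l2 u' • u + l2 u • u')))
  have hneg0 := sq_nonneg (l2 (X.mulVec (l2 u' • u + -l2 u • u')))
  rw [hexp] at hpos hneg hpos0 hneg0
  rw [abs_le]
  constructor <;> refine le_of_mul_le_mul_left ?_ hab <;> linarith

/-- Cauchy–Schwarz bound on restricted orthogonality without the
lower sparse eigenvalue condition. -/
theorem statement_4
    (n p s : ℕ) (hn : 0 < n) (hs : 1 ≤ s) (h2s : 2 * s ≤ p)
    (X : Matrix (Fin n) (Fin p) ℝ)
    (Lmax2s Lmaxs : ℝ)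
    (hLmax2s : IsLambdaMax X (2 * s) Lmax2s)
    (hLmaxs : IsLambdaMax X s Lmaxs) :
    (∀ (T T' : Finset (Fin p)) (u u' : Fin p → ℝ) (LT LT' : ℝ),
      Disjoint T T' → T.card ≤ s → T'.card ≤ s →
      (∀ j, j ∉ T → u j = 0) → (∀ j, j ∉ T' → u' j = 0) →
      IsLambdaMax X T.card LT → IsLambdaMax X T'.card LT' →
      |∑ i, (X.mulVec u i) * (X.mulVec u' i)| / n ≤
        min (Real.sqrt (LT * LT')) (Lmax2s / 2) * (l2 u * l2 u')) ∧
    ∀ (m m' : ℕ) (θ : ℝ), 1 ≤ m → m ≤ s → 1 ≤ m' → m' ≤ s →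
      IsTheta X m m' θ → θ ≤ min Lmaxs (Lmax2s / 2) := by
  refine ⟨fun T T' u u' LT LT' hd hT hT' hu hu' hLT hLT' => ?_,
    fun m m' θ _ hm _ hm' hθ => hθ.2 ⟨?_, fun u u' T T' hd hT hT' hu hu' => ?_⟩⟩
  · rw [min_mul_of_nonneg _ _ (mul_nonneg (l2_nonneg u) (l2_nonneg u'))]
    exact le_min (abs_sum_mulVec_mul_div_le_sqrt hn hLT hLT' le_rfl le_rfl hu hu')
      (abs_sum_mulVec_mul_div_le_half hn hLmax2s hd (by omega) hu hu')
  · exact le_min hLmaxs.nonneg (div_nonneg hLmax2s.nonneg zero_le_two)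
  · rw [min_mul_of_nonneg _ _ (mul_nonneg (l2_nonneg u) (l2_nonneg u'))]
    refine le_min ?_ (abs_sum_mulVec_mul_div_le_half hn hLmax2s hd (by omega) hu hu')
    rw [← Real.sqrt_mul_self hLmaxs.nonneg]
    exact abs_sum_mulVec_mul_div_le_sqrt hn hLmaxs hLmaxs (hT.trans hm) (hT'.trans hm') hu hu'

end ThreshLasso
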